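/- There is no blocking semioval with exactly 25 points in PG(2,11). -/

import Mathlib

instance : Fact (Nat.Prime 11) := ⟨by norm_num⟩

/-- The points of `PG(2,11)`: the projectivization of `(ZMod 11)^3`. -/
abbrev PGPoint : Type := Projectivization (ZMod 11) (Fin 3 → ZMod 11)

/-- The lines of `PG(2,11)`: the 2-dimensional subspaces of `(ZMod 11)^3`. -/
abbrev PGLine : Type :=
  {W : Submodule (ZMod 11) (Fin 3 → ZMod 11) // Module.finrank (ZMod 11) W = 2}

/-- Incidence: a point lies on a line when its representing 1-dimensional
subspace is contained in the line's 2-dimensional subspace. -/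
def PGmem (P : PGPoint) (L : PGLine) : Prop := Projectivization.submodule P ≤ L.val

/-- The set of points lying on a line. -/
def linePts (L : PGLine) : Set PGPoint := {P | PGmem P L}

/-- The set of points of `S` lying on the line `L`. -/
def secantPts (S : Set PGPoint) (L : PGLine) : Set PGPoint := {P ∈ S | PGmem P L}

/-- A line is a `k`-secant to `S` if it meets `S` in exactly `k` points. -/
def IsSecant (S : Set PGPoint) (k : ℕ) (L : PGLine) : Prop := (secantPts S L).ncard = k

/-- A tangent line to `S` is a 1-secant. -/
def IsTangent (S : Set PGPoint) (L : PGLine) : Prop := IsSecant S 1 L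

/-- A blocking set: every line meets `S`, but `S` contains no line. -/
def IsBlockingSet (S : Set PGPoint) : Prop :=
  (∀ L : PGLine, (secantPts S L).Nonempty) ∧ ∀ L : PGLine, ¬ linePts L ⊆ S

/-- A semioval: every point of `S` lies on exactly one tangent line to `S`. -/
def IsSemioval (S : Set PGPoint) : Prop :=
  ∀ P ∈ S, ∃! L : PGLine, PGmem P L ∧ IsTangent S L

/-- A blocking semioval is both a blocking set and a semioval. -/
def IsBlockingSemioval (S : Set PGPoint) : Prop := IsBlockingSet S ∧ IsSemioval S

open Finset

section LinearSpace

variable {P L : Type*} [Fintype L] {I : P → L → Prop} [DecidableRel I]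

/-- In a linear space, the intersection numbers of a set `S` with the lines through `p` count every
point of `S` other than `p` once, and `p`, if it is in `S`, once for each line through it. -/
theorem sum_card_filter_lines_through [DecidableEq P]
    (hline : ∀ p q, p ≠ q → #{l | I p l ∧ I q l} = 1) (S : Finset P) (p : P) :
    ∑ l with I p l, #{x ∈ S | I x l} =
      #(S.erase p) + if p ∈ S then #{l | I p l} else 0 := by
  have h : ∑ l with I p l, #{x ∈ S | I x l} = ∑ x ∈ S, #{l | I p l ∧ I x l} := by
    simp only [card_filter, sum_filter]
    rw [sum_congr rfl fun l _ => (by split_ifs <;> simp [*] :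
      (if I p l then ∑ x ∈ S, (if I x l then 1 else 0) else 0) =
        ∑ x ∈ S, if I p l ∧ I x l then 1 else 0)]
    exact sum_comm
  have herase : ∑ x ∈ S.erase p, #{l | I p l ∧ I x l} = #(S.erase p) := by
    rw [sum_congr rfl fun x hx => hline p x (ne_of_mem_erase hx).symm]
    simp
  rw [h]
  split_ifs with hp
  · rw [← add_sum_erase S _ hp, herase, add_comm]
    simp
  · rw [erase_eq_of_notMem hp] at herase ⊢
    simpa using herase

theorem card_lines_through_of_card_line [Fintype P] {n : ℕ} (hn : 1 ≤ n)
    (hline : ∀ p q, p ≠ q → #{l | I p l ∧ I q l} = 1)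
    (hcard : Fintype.card P = n ^ 2 + n + 1) (hpts : ∀ l, #{p | I p l} = n + 1) (p : P) :
    #{l | I p l} = n + 1 := by
  classical
  have h := sum_card_filter_lines_through hline univ p
  simp only [hpts, sum_const, smul_eq_mul, mem_univ, if_true, card_erase_of_mem, card_univ,
    hcard] at h
  have : #{l | I p l} * n = (n + 1) * n := by
    have : n ^ 2 + n + 1 - 1 = (n + 1) * n := by rw [Nat.add_sub_cancel]; ring
    rw [this] at h
    linarith
  exact Nat.eq_of_mul_eq_mul_right hn this

theorem card_lines_of_card_line [Fintype P] {n : ℕ} (hn : 1 ≤ n)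
    (hline : ∀ p q, p ≠ q → #{l | I p l ∧ I q l} = 1)
    (hcard : Fintype.card P = n ^ 2 + n + 1) (hpts : ∀ l, #{p | I p l} = n + 1) :
    Fintype.card L = n ^ 2 + n + 1 := by
  have h := sum_card_bipartiteAbove_eq_sum_card_bipartiteBelow I (s := univ) (t := univ)
  simp only [bipartiteAbove, bipartiteBelow, hpts,
    card_lines_through_of_card_line hn hline hcard hpts, sum_const, card_univ, hcard,
    smul_eq_mul] at h
  exact (Nat.eq_of_mul_eq_mul_right n.succ_pos h).symm

/-- Weighting the lines and summing over the lines through each point of `A`. -/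
theorem sum_sum_lines_through (A : Finset P) (w : L → ℕ) :
    ∑ p ∈ A, ∑ l with I p l, w l = ∑ l, w l * #{p ∈ A | I p l} := by
  simp only [sum_filter]
  rw [sum_comm]
  refine sum_congr rfl fun l _ => ?_
  rw [← sum_filter, sum_const, smul_eq_mul, mul_comm]

theorem card_inter_le_one (hline : ∀ p q, p ≠ q → #{l | I p l ∧ I q l} = 1) (S : Finset P)
    {l m : L} (hlm : l ≠ m) : #{p ∈ {p ∈ S | I p l} | I p m} ≤ 1 := by
  refine card_le_one.2 fun p hp q hq => ?_
  simp only [mem_filter] at hp hq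
  by_contra hpq
  have := card_le_one.1 (hline p q hpq).le l (by simp [hp, hq]) m (by simp [hp, hq])
  exact hlm this


theorem sum_comp_eq_sum_card_mul {α : Type*} (s : Finset α) (g : α → ℕ) (T : Finset ℕ)
    (h : ∀ x ∈ s, g x ∈ T) (f : ℕ → ℕ) :
    ∑ x ∈ s, f (g x) = ∑ i ∈ T, #{x ∈ s | g x = i} * f i := by
  rw [← sum_fiberwise_of_maps_to h]
  refine sum_congr rfl fun i _ => ?_
  rw [sum_congr rfl fun x hx => by rw [(mem_filter.1 hx).2], sum_const, smul_eq_mul]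

theorem exists_mem_eq_one_of_sum_eq_one {α : Type*} {s : Finset α} {f : α → ℕ}
    (h : ∑ x ∈ s, f x = 1) : ∃ x ∈ s, f x = 1 := by
  obtain ⟨x, hx, hx0⟩ := exists_ne_zero_of_sum_ne_zero (h.trans_ne one_ne_zero)
  have := single_le_sum (fun i _ => Nat.zero_le (f i)) hx
  exact ⟨x, hx, by omega⟩

/-- In a projective plane of order 11, a 25-point semioval meeting every line has a line meeting it
in at least 10 points. -/
theorem exists_ten_le_secant_of_semioval_card_25 [Fintype P]
    (hline : ∀ p q, p ≠ q → #{l | I p l ∧ I q l} = 1)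
    (hcard : Fintype.card P = 133) (hpts : ∀ l, #{p | I p l} = 12)
    (S : Finset P) (hS : #S = 25) (hblock : ∀ l, 1 ≤ #{x ∈ S | I x l})
    (htan : ∀ p ∈ S, #{l | I p l ∧ #{x ∈ S | I x l} = 1} = 1) :
    ∃ l, 10 ≤ #{x ∈ S | I x l} := by
  classical
  by_contra! hmax
  have hdeg := card_lines_through_of_card_line (n := 11) (by norm_num) hline hcard hpts
  have hL := card_lines_of_card_line (n := 11) (by norm_num) hline hcard hpts
  norm_num at hdeg hL
  have hthrough : ∀ p ∈ S, ∑ l with I p l, #{x ∈ S | I x l} = 36 := fun p hp => by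
    rw [sum_card_filter_lines_through hline, if_pos hp, card_erase_of_mem hp, hS, hdeg]
  have hmeet : ∀ l m, l ≠ m → #{p ∈ {p ∈ S | I p l} | I p m} ≤ 1 :=
    fun l m => card_inter_le_one hline S
  have hself : ∀ l, #{p ∈ {p ∈ S | I p l} | I p l} = #{x ∈ S | I x l} := fun l => by
    simp [filter_filter]
  have hdouble : ∀ (A : Finset P) (w : L → ℕ),
      ∑ p ∈ A, ∑ l with I p l, w l = ∑ l, w l * #{p ∈ A | I p l} := sum_sum_lines_through
  have hdouble' : ∀ (l : L) (w : L → ℕ), ∑ p ∈ {p ∈ S | I p l}, ∑ m with I p m, w m =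
      w l * #{x ∈ S | I x l} +
        ∑ m ∈ univ.erase l, w m * #{p ∈ {p ∈ S | I p l} | I p m} := fun l w => by
    rw [hdouble, ← add_sum_erase univ _ (mem_univ l), hself]
  obtain ⟨k, hk⟩ : ∃ k : L → ℕ, ∀ l, #{x ∈ S | I x l} = k l := ⟨_, fun _ => rfl⟩
  obtain ⟨c, hc⟩ : ∃ c : L → L → ℕ, ∀ l m, #{p ∈ {p ∈ S | I p l} | I p m} = c l m :=
    ⟨_, fun _ _ => rfl⟩
  simp only [hk] at hblock htan hmax hthrough hdouble' hself
  simp only [hc] at hmeet hdouble' hself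
  -- indicator of tangents, and excess over two
  set w : L → ℕ := fun l => if k l = 1 then 1 else 0 with hw
  set j : L → ℕ := fun l => k l - 2 with hj
  have hkwj : ∀ l, k l + w l = j l + 2 := fun l => by
    have := hblock l
    simp only [hw, hj]
    split_ifs <;> omega
  have hsumk : ∑ l, k l = 300 := by
    have := hdouble S fun _ => 1
    simpa [hdeg, hS, hk] using this.symm
  have hsumk2 : ∑ l, k l * k l = 900 := by
    have := hdouble S k
    simp only [hk] at this
    rw [← this, sum_congr rfl hthrough]
    simp [hS]
  have hwthrough : ∀ p ∈ S, ∑ l with I p l, w l = 1 := fun p hp => by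
    rw [← htan p hp, card_filter, sum_filter]
    refine sum_congr rfl fun l _ => ?_
    simp only [hw]
    split_ifs <;> simp_all
  have hsumw : ∑ l, w l = 25 := by
    have := hdouble S w
    simp only [hk] at this
    rw [sum_congr rfl hwthrough] at this
    simp only [sum_const, hS, smul_eq_mul, mul_one] at this
    rw [this]
    refine sum_congr rfl fun l _ => ?_
    simp only [hw]
    split_ifs <;> simp_all
  have hsumj : ∑ l, j l = 59 := by
    have : ∑ l, (k l + w l) = ∑ l, (j l + 2) := sum_congr rfl fun l _ => hkwj l
    simp only [sum_add_distrib, hsumk, hsumw, sum_const, card_univ, hL, smul_eq_mul] at this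
    omega
  have hjthrough : ∀ p ∈ S, ∑ l with I p l, j l = 13 := fun p hp => by
    have : ∑ l with I p l, (k l + w l) = ∑ l with I p l, (j l + 2) :=
      sum_congr rfl fun l _ => hkwj l
    simp only [sum_add_distrib, hthrough p hp, hwthrough p hp, sum_const, hdeg,
      smul_eq_mul] at this
    omega
  have hjmeet : ∀ l, 13 * k l = j l * k l + ∑ m ∈ univ.erase l, j m * c l m := fun l => by
    rw [← hdouble' l j, sum_congr rfl fun p hp => hjthrough p (mem_filter.1 hp).1,
      sum_const, hk, smul_eq_mul, mul_comm]
  have hjerase : ∀ l, j l + ∑ m ∈ univ.erase l, j m = 59 := fun l => by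
    rw [add_sum_erase univ _ (mem_univ l), hsumj]
  have hsplit : ∀ l, ∑ m ∈ univ.erase l, j m =
      ∑ m ∈ univ.erase l, j m * c l m + ∑ m ∈ univ.erase l, j m * (1 - c l m) := fun l => by
    rw [← sum_add_distrib]
    refine sum_congr rfl fun m hm => ?_
    have := hmeet l m (ne_of_mem_erase hm).symm
    rw [← mul_add, Nat.add_sub_cancel' this, mul_one]
  have hk6 : ∀ l, k l ∈ Icc 1 6 := fun l => by
    have h1 := hblock l
    have h2 := hmax l
    have h3 := hjmeet l
    have h4 := hjerase l
    have h5 := hsplit l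
    have h6 : j l = k l - 2 := rfl
    rw [h6] at h3 h4
    generalize k l = n at *
    rw [mem_Icc]
    interval_cases n <;> omega
  have hsix : ∀ l, k l = 6 → ∑ m ∈ univ.erase l, j m * (1 - c l m) = 1 := fun l hl => by
    have h3 := hjmeet l
    have h4 := hjerase l
    have h5 := hsplit l
    have h6 : j l = k l - 2 := rfl
    rw [h6, hl] at h3 h4
    omega
  have hsix_meet : ∀ l m, k l = 6 → k m = 6 → l ≠ m → c l m = 1 := fun l m hl hm hlm => by
    have h1 := hsix l hl
    have h2 := single_le_sum (f := fun m => j m * (1 - c l m)) (fun i _ => Nat.zero_le _)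
      (mem_erase.2 ⟨hlm.symm, mem_univ m⟩)
    have h3 := hmeet l m hlm
    have h6 : j m = k m - 2 := rfl
    simp only [h6, hm, h1] at h2
    omega
  have hthree : ∀ l, k l = 6 → ∃ m, k m = 3 := fun l hl => by
    obtain ⟨m, -, hm⟩ := exists_mem_eq_one_of_sum_eq_one (hsix l hl)
    have h6 : j m = k m - 2 := rfl
    have := Nat.eq_one_of_mul_eq_one_right hm
    exact ⟨m, by omega⟩
  have hfib := sum_comp_eq_sum_card_mul univ k (Icc 1 6) fun l _ => hk6 l
  have hIcc : Icc 1 6 = ({1, 2, 3, 4, 5, 6} : Finset ℕ) := rfl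
  have e0 := hfib fun _ => 1
  have e1 := hfib fun n => n
  have e2 := hfib fun n => n * n
  have e3 := hfib fun n => if n = 1 then 1 else 0
  rw [hsumk] at e1
  rw [hsumk2] at e2
  rw [hsumw] at e3
  simp [hIcc, hL] at e0 e1 e2 e3
  -- six-secants through a point
  set u : L → ℕ := fun l => if k l = 6 then 1 else 0 with hu
  set a : P → ℕ := fun p => ∑ l with I p l, u l with ha
  set v : L → ℕ := fun l => if k l = 3 then 1 else 0 with hv
  have hsumu : ∑ l, u l = #{l | k l = 6} := by simp [hu]
  have hsumv : ∑ l, v l = #{l | k l = 3} := by simp [hv]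
  have hasplit : ∀ p ∈ S, 4 * a p + ∑ l with I p l, j l * (1 - u l) = 13 := fun p hp => by
    rw [← hjthrough p hp, ha, mul_sum, ← sum_add_distrib]
    refine sum_congr rfl fun l _ => ?_
    simp only [hu, hj]
    split_ifs <;> simp [*]
  have ha3 : ∀ p ∈ S, a p ∈ range 4 := fun p hp => by
    have := hasplit p hp
    rw [mem_range]
    omega
  have hsuma : ∑ p ∈ S, a p = #{l | k l = 6} * 6 := by
    rw [ha, hdouble, ← hsumu, sum_mul]
    refine sum_congr rfl fun l _ => ?_
    rw [hk]
    simp only [hu]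
    split_ifs <;> simp [*]
  have hsuma_six : ∀ l, k l = 6 → ∑ p ∈ {p ∈ S | I p l}, a p = #{l | k l = 6} + 5 :=
    fun l hl => by
      have hul : u l = 1 := if_pos hl
      have hc1 : ∑ m ∈ univ.erase l, u m * c l m = ∑ m ∈ univ.erase l, u m := by
        refine sum_congr rfl fun m hm => ?_
        by_cases h : k m = 6
        · rw [hsix_meet l m hl h (ne_of_mem_erase hm).symm, mul_one]
        · simp [hu, h]
      have := add_sum_erase univ u (mem_univ l)
      rw [ha, hdouble', hc1, hl, hul]
      omega
  have hsuma2 : ∑ p ∈ S, a p * a p = #{l | k l = 6} * (#{l | k l = 6} + 5) := by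
    have h1 : ∑ p ∈ S, a p * a p = ∑ l, u l * ∑ p ∈ {p ∈ S | I p l}, a p := by
      simp only [mul_sum, sum_filter]
      rw [sum_comm]
      refine sum_congr rfl fun p _ => ?_
      change (∑ l with I p l, u l) * a p = _
      rw [sum_mul, sum_filter]
      exact sum_congr rfl fun l _ => (mul_ite_zero ..).symm
    rw [h1]
    conv_rhs => rw [← hsumu, sum_mul]
    refine sum_congr rfl fun l _ => ?_
    by_cases h : k l = 6
    · rw [hsuma_six l h, hsumu]
    · simp [hu, h]
  have hcard3 : #{p ∈ S | a p = 3} ≤ #{l | k l = 3} * 3 := by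
    have h1 : ∑ p ∈ S, ∑ l with I p l, v l = #{l | k l = 3} * 3 := by
      rw [hdouble, ← hsumv, sum_mul]
      refine sum_congr rfl fun l _ => ?_
      rw [hk]
      simp only [hv]
      split_ifs <;> simp [*]
    rw [← h1, card_filter]
    refine sum_le_sum fun p hp => ?_
    split_ifs with h
    · have h2 := hasplit p hp
      obtain ⟨l, hl, hl1⟩ := exists_mem_eq_one_of_sum_eq_one
        (show ∑ l with I p l, j l * (1 - u l) = 1 by omega)
      have h3 : j l = k l - 2 := rfl
      have h4 := Nat.eq_one_of_mul_eq_one_right hl1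
      have h5 : v l = 1 := if_pos (by omega)
      rw [← h5]
      exact single_le_sum (fun i _ => Nat.zero_le _) hl
    · exact Nat.zero_le _
  have hfiba := sum_comp_eq_sum_card_mul S a (range 4) ha3
  have f0 := hfiba fun _ => 1
  have f1 := hfiba fun n => n
  have f2 := hfiba fun n => n * n
  rw [hsuma] at f1
  rw [hsuma2] at f2
  simp [sum_range_succ, hS] at f0 f1 f2
  have h63 : #{l | k l = 6} ≠ 0 → 1 ≤ #{l | k l = 3} := fun h => by
    obtain ⟨l, hl⟩ := card_pos.1 (Nat.pos_of_ne_zero h)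
    obtain ⟨m, hm⟩ := hthree l (mem_filter.1 hl).2
    exact card_pos.2 ⟨m, by simp [hm]⟩
  generalize #{l | k l = 6} = t6 at *
  have ht6 : t6 ≤ 25 := by omega
  clear hfib hfiba
  interval_cases t6 <;> omega

end LinearSpace

theorem PGmem_mk_iff {v : Fin 3 → ZMod 11} (hv : v ≠ 0) (L : PGLine) :
    PGmem (Projectivization.mk _ v hv) L ↔ v ∈ L.val := by
  rw [PGmem, Projectivization.submodule_mk, Submodule.span_singleton_le_iff_mem]

theorem PGmem_iff_rep_mem (P : PGPoint) (L : PGLine) : PGmem P L ↔ P.rep ∈ L.val := by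
  rw [PGmem, Projectivization.submodule_eq, Submodule.span_singleton_le_iff_mem]

theorem card_PGPoint : Nat.card PGPoint = 133 := by
  rw [Projectivization.card_of_finrank (ZMod 11) (Fin 3 → ZMod 11) (n := 3) (by simp)]
  simp [Finset.sum_range_succ]

theorem ncard_linePts (L : PGLine) : (linePts L).ncard = 12 := by
  have h : linePts L = Set.range (Projectivization.map L.val.subtype L.val.injective_subtype) := by
    ext P
    constructor
    · intro hP
      have hmem : P.rep ∈ L.val := (PGmem_iff_rep_mem P L).1 hP
      refine ⟨Projectivization.mk _ ⟨P.rep, hmem⟩ fun h => P.rep_nonzero (congrArg Subtype.val h),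
        ?_⟩
      rw [Projectivization.map_mk]
      exact P.mk_rep
    · rintro ⟨Q, rfl⟩
      induction Q using Projectivization.ind with
      | h v hv =>
        rw [Projectivization.map_mk]
        exact (PGmem_mk_iff _ L).2 v.2
  rw [h, ← Nat.card_coe_set_eq,
    Nat.card_range_of_injective (Projectivization.map_injective _ _),
    Projectivization.card_of_finrank_two _ _ L.2]
  simp

theorem existsUnique_line {P Q : PGPoint} (hPQ : P ≠ Q) :
    ∃! L : PGLine, PGmem P L ∧ PGmem Q L := by
  have hli := (Projectivization.linearIndependent_pair_iff_ne).2 hPQ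
  have hrank : Module.finrank (ZMod 11) ↥(P.submodule ⊔ Q.submodule) = 2 := by
    rw [Projectivization.submodule_eq, Projectivization.submodule_eq, ← Submodule.span_union]
    have := finrank_span_eq_card hli
    rw [Matrix.range_cons, Matrix.range_cons, Matrix.range_empty, Set.union_empty] at this
    simpa using this
  refine ⟨⟨_, hrank⟩, ⟨le_sup_left, le_sup_right⟩, fun L hL => Subtype.ext ?_⟩
  exact (Submodule.eq_of_le_of_finrank_eq (sup_le hL.1 hL.2) (hrank.trans L.2.symm)).symm

theorem exists_common_point (L M : PGLine) : ∃ P : PGPoint, PGmem P L ∧ PGmem P M := by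
  have h1 := Submodule.finrank_sup_add_finrank_inf_eq L.val M.val
  have h2 := Submodule.finrank_le (L.val ⊔ M.val)
  have hne : L.val ⊓ M.val ≠ ⊥ := fun h => by
    rw [h, L.2, M.2, finrank_bot] at h1
    simp at h2
    omega
  obtain ⟨v, hv, hv0⟩ := Submodule.exists_mem_ne_zero_of_ne_bot hne
  exact ⟨Projectivization.mk _ v hv0, (PGmem_mk_iff hv0 L).2 hv.1, (PGmem_mk_iff hv0 M).2 hv.2⟩

/-- The line of `PG(2,11)` with dual coordinates `a`. -/
theorem exists_line_of_coords {a : Fin 3 → ZMod 11} (ha : a ≠ 0) :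
    ∃ L : PGLine, ∀ x, x ∈ L.val ↔ a ⬝ᵥ x = 0 := by
  have hne : dotProductBilin (ZMod 11) (ZMod 11) a ≠ 0 := fun h =>
    ha (dotProduct_eq_zero a fun x => LinearMap.congr_fun h x)
  have := Module.Dual.finrank_ker_add_one_of_ne_zero hne
  simp at this
  exact ⟨⟨LinearMap.ker (dotProductBilin (ZMod 11) (ZMod 11) a), by omega⟩, fun x => by simp⟩

theorem exists_coords (L : PGLine) :
    ∃ a : Fin 3 → ZMod 11, ∀ x, x ∈ L.val ↔ a ⬝ᵥ x = 0 := by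
  have hlt : L.val < ⊤ := lt_top_iff_ne_top.2 fun h => by
    have := L.2
    rw [h] at this
    simp at this
  obtain ⟨f, hf, hle⟩ := L.val.exists_le_ker_of_lt_top hlt
  have hrank := Module.Dual.finrank_ker_add_one_of_ne_zero hf
  simp at hrank
  have heq := Submodule.eq_of_le_of_finrank_eq hle (L.2.trans (by omega))
  refine ⟨fun i => f fun j => if i = j then 1 else 0, fun x => ?_⟩
  rw [heq, LinearMap.mem_ker, LinearMap.pi_apply_eq_sum_univ f x]
  simp only [dotProduct, smul_eq_mul, mul_comm]

/-- Jamison's bound in the affine plane of order 11: at most 20 points off the line `L` miss some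
line other than `L`. -/
theorem exists_line_missing (B : Finset PGPoint) (hB : B.Nonempty) (hcard : #B ≤ 20) (L : PGLine)
    (hL : ∀ P ∈ B, ¬ PGmem P L) : ∃ M, M ≠ L ∧ ∀ P ∈ B, ¬ PGmem P M := by
  classical
  by_contra! hcon
  obtain ⟨P₀, hP₀⟩ := hB
  obtain ⟨b, hb⟩ := exists_coords L
  have hb0 : b ⬝ᵥ P₀.rep ≠ 0 := fun h => hL P₀ hP₀ ((PGmem_iff_rep_mem _ _).2 ((hb _).2 h))
  set a := (b ⬝ᵥ P₀.rep)⁻¹ • b with ha_def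
  have ha : ∀ x, x ∈ L.val ↔ a ⬝ᵥ x = 0 := fun x => by
    rw [hb, ha_def, smul_dotProduct, smul_eq_mul, mul_eq_zero, or_iff_right (inv_ne_zero hb0)]
  have ha1 : a ⬝ᵥ P₀.rep = 1 := by
    rw [ha_def, smul_dotProduct, smul_eq_mul, inv_mul_cancel₀ hb0]
  let lin : (Fin 3 → ZMod 11) → MvPolynomial (Fin 3) (ZMod 11) := fun x =>
    ∑ i, MvPolynomial.C (x i) * MvPolynomial.X i
  have hlin : ∀ x y, MvPolynomial.eval y (lin x) = y ⬝ᵥ x := fun x y => by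
    simp [lin, dotProduct, mul_comm]
  have hdeg : ∀ x, (lin x).totalDegree ≤ 1 := fun x =>
    MvPolynomial.totalDegree_finsetSum_le fun i _ =>
      (MvPolynomial.totalDegree_mul _ _).trans (by simp)
  let G : MvPolynomial (Fin 3) (ZMod 11) :=
    (∏ P ∈ B.erase P₀, lin P.rep) * (1 - (lin P₀.rep - MvPolynomial.C 1) ^ 10)
  have hG : ∀ y, MvPolynomial.eval y G =
      (∏ P ∈ B.erase P₀, y ⬝ᵥ P.rep) * (1 - (y ⬝ᵥ P₀.rep - 1) ^ 10) := fun y => by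
    simp only [G, map_mul, map_prod, map_sub, map_pow, map_one, hlin]
  have hGdeg : G.totalDegree < (Fintype.card (ZMod 11) - 1) * Fintype.card (Fin 3) := by
    have h1 : (∏ P ∈ B.erase P₀, lin P.rep).totalDegree ≤ 19 := by
      refine (MvPolynomial.totalDegree_finsetProd _ _).trans
        ((sum_le_card_nsmul _ _ 1 fun P _ => hdeg _).trans ?_)
      rw [card_erase_of_mem hP₀, smul_eq_mul]
      omega
    have h2 : ((lin P₀.rep - MvPolynomial.C 1) ^ 10).totalDegree ≤ 10 :=
      (MvPolynomial.totalDegree_pow _ _).trans (by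
        have := (MvPolynomial.totalDegree_sub_C_le (lin P₀.rep) 1).trans (hdeg _)
        omega)
    have h3 : (1 - (lin P₀.rep - MvPolynomial.C 1) ^ 10).totalDegree ≤ 10 :=
      (MvPolynomial.totalDegree_sub _ _).trans (by simpa using h2)
    have h4 : G.totalDegree ≤ _ := MvPolynomial.totalDegree_mul _ _
    rw [ZMod.card, Fintype.card_fin]
    omega
  have hsum := MvPolynomial.sum_eval_eq_zero G hGdeg
  rw [Fintype.sum_eq_single a] at hsum
  · rw [hG, ha1] at hsum
    simp only [sub_self, ne_eq, OfNat.ofNat_ne_zero, not_false_eq_true, zero_pow, sub_zero,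
      mul_one, prod_eq_zero_iff] at hsum
    obtain ⟨P, hP, hP0⟩ := hsum
    exact hL P (mem_of_mem_erase hP) ((PGmem_iff_rep_mem _ _).2 ((ha _).2 hP0))
  · intro y hya
    by_contra hy
    rw [hG, mul_eq_zero, not_or, prod_eq_zero_iff] at hy
    have hy1 : y ⬝ᵥ P₀.rep = 1 := by
      by_contra h
      exact hy.2 (by rw [ZMod.pow_card_sub_one_eq_one (p := 11) (sub_ne_zero.2 h), sub_self])
    obtain ⟨M, hM⟩ := exists_line_of_coords (a := y) (by rintro rfl; simp at hy1)
    have hML : M ≠ L := by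
      rintro rfl
      refine hya (sub_eq_zero.1 (dotProduct_eq_zero _ fun x => ?_))
      have h1 : x - (y ⬝ᵥ x) • P₀.rep ∈ M.val := (hM _).2 (by
        rw [dotProduct_sub, dotProduct_smul, hy1]; simp)
      have h2 := (ha _).1 h1
      rw [dotProduct_sub, dotProduct_smul, ha1] at h2
      simp at h2
      rw [sub_dotProduct, ← neg_sub, h2, neg_zero]
    obtain ⟨P, hP, hPM⟩ := hcon M hML
    rw [PGmem_iff_rep_mem, hM] at hPM
    by_cases hPP : P = P₀
    · rw [hPP, hy1] at hPM
      exact one_ne_zero hPM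
    · exact hy.1 ⟨P, mem_erase.2 ⟨hPP, hP⟩, hPM⟩

theorem eq_of_mem_two_lines {L M : PGLine} (hLM : L ≠ M) {P Q : PGPoint} (hPL : PGmem P L)
    (hPM : PGmem P M) (hQL : PGmem Q L) (hQM : PGmem Q M) : P = Q := by
  by_contra h
  exact hLM ((existsUnique_line h).unique ⟨hPL, hQL⟩ ⟨hPM, hQM⟩)

theorem exists_point_on_not_on {L M : PGLine} (hLM : M ≠ L) :
    ∃ P : PGPoint, PGmem P M ∧ ¬ PGmem P L := by
  have hle : ¬ M.val ≤ L.val := fun h =>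
    hLM (Subtype.ext (Submodule.eq_of_le_of_finrank_eq h (M.2.trans L.2.symm)))
  obtain ⟨v, hvM, hvL⟩ := SetLike.not_le_iff_exists.1 hle
  have hv : v ≠ 0 := fun h => hvL (h ▸ L.val.zero_mem)
  exact ⟨Projectivization.mk _ v hv, (PGmem_mk_iff hv M).2 hvM, fun h =>
    hvL ((PGmem_mk_iff hv L).1 h)⟩

/-- Lines other than `L` meeting `L` in distinct points can be covered, two at a time, by points
off `L`. -/
theorem exists_cover_off_line (L : PGLine) (T : Finset PGLine) (hT : ∀ M ∈ T, M ≠ L)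
    (hmeet : ∀ M ∈ T, ∀ N ∈ T, M ≠ N → ∀ P, PGmem P M → PGmem P N → ¬ PGmem P L) :
    ∃ C : Finset PGPoint, 2 * #C ≤ #T + 1 ∧ (∀ P ∈ C, ¬ PGmem P L) ∧
      ∀ M ∈ T, ∃ P ∈ C, PGmem P M := by
  classical
  induction T using Finset.strongInduction with
  | H T ih =>
    obtain rfl | ⟨M, hM⟩ := T.eq_empty_or_nonempty
    · exact ⟨∅, by simp⟩
    obtain hT1 | ⟨N, hN⟩ := (T.erase M).eq_empty_or_nonempty
    · obtain ⟨P, hPM, hPL⟩ := exists_point_on_not_on (hT M hM)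
      refine ⟨{P}, ?_, by simpa using hPL, fun N hN => ⟨P, by simp, ?_⟩⟩
      · have := card_pos.2 ⟨M, hM⟩
        simp only [card_singleton]
        omega
      · by_contra hPN
        have : N ∈ T.erase M := mem_erase.2 ⟨fun h => hPN (h ▸ hPM), hN⟩
        simp [hT1] at this
    · have hsub : (T.erase M).erase N ⊆ T := (erase_subset _ _).trans (erase_subset _ _)
      obtain ⟨C, hC, hCL, hCT⟩ := ih ((T.erase M).erase N)
        ((erase_ssubset hN).trans (erase_ssubset hM)) (fun K hK => hT K (hsub hK))
        fun K hK K' hK' => hmeet K (hsub hK) K' (hsub hK')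
      obtain ⟨P, hPM, hPN⟩ := exists_common_point M N
      have hPL := hmeet M hM N (mem_of_mem_erase hN) (ne_of_mem_erase hN).symm P hPM hPN
      refine ⟨insert P C, ?_, fun Q hQ => ?_, fun K hK => ?_⟩
      · have h1 := card_insert_le P C
        have h2 := card_erase_add_one hN
        have h3 := card_erase_add_one hM
        omega
      · obtain rfl | hQ := mem_insert.1 hQ
        exacts [hPL, hCL Q hQ]
      · by_cases hKM : K = M
        · exact ⟨P, mem_insert_self _ _, hKM ▸ hPM⟩
        by_cases hKN : K = N
        · exact ⟨P, mem_insert_self _ _, hKN ▸ hPN⟩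
        obtain ⟨Q, hQ, hQK⟩ := hCT K (mem_erase.2 ⟨hKN, mem_erase.2 ⟨hKM, hK⟩⟩)
        exact ⟨Q, mem_insert_of_mem hQ, hQK⟩

open Classical in
theorem ncard_secantPts_coe (S : Finset PGPoint) (L : PGLine) :
    (secantPts (S : Set PGPoint) L).ncard = #{P ∈ S | PGmem P L} := by
  rw [← Set.ncard_coe_finset]
  congr 1
  ext P
  simp [secantPts]

/-- The affine blocking set bound limits the secants of a blocking semioval with 25 points. -/
theorem IsBlockingSemioval.ncard_secantPts_lt_ten {S : Set PGPoint} (hS : IsBlockingSemioval S)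
    (hcard : S.ncard = 25) (L : PGLine) : (secantPts S L).ncard < 10 := by
  classical
  lift S to Finset PGPoint using S.toFinite
  rw [Set.ncard_coe_finset] at hcard
  by_contra! hL
  obtain ⟨⟨hblock, -⟩, htan⟩ := hS
  have : Nonempty PGLine := ⟨L⟩
  choose! t ht htu using htan
  have htL : ∀ P ∈ S, t P ≠ L := fun P hP h => by
    have : (secantPts (S : Set PGPoint) (t P)).ncard = 1 := (ht P hP).2
    rw [h] at this
    omega
  rw [ncard_secantPts_coe] at hL
  set A := {P ∈ S | PGmem P L}
  have hAS : ∀ P ∈ A, P ∈ S ∧ PGmem P L := fun P hP => mem_filter.1 hP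
  obtain ⟨C, hC, hCL, hCT⟩ := exists_cover_off_line L (A.image t)
    (fun M hM => by
      obtain ⟨P, hP, rfl⟩ := mem_image.1 hM
      exact htL P (hAS P hP).1)
    (fun M hM N hN hMN Q hQM hQN hQL => by
      obtain ⟨P, hP, rfl⟩ := mem_image.1 hM
      obtain ⟨P', hP', rfl⟩ := mem_image.1 hN
      obtain ⟨hPS, hPL⟩ := hAS P hP
      obtain ⟨hPS', hPL'⟩ := hAS P' hP'
      have h1 := eq_of_mem_two_lines (htL P hPS) (ht P hPS).1 hPL hQM hQL
      have h2 := eq_of_mem_two_lines (htL P' hPS') (ht P' hPS').1 hPL' hQN hQL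
      exact hMN (by rw [h1, h2]))
  set B := {P ∈ S | ¬ PGmem P L} ∪ C
  have hBL : ∀ P ∈ B, ¬ PGmem P L := fun P hP => by
    obtain hP | hP := mem_union.1 hP
    exacts [(mem_filter.1 hP).2, hCL P hP]
  have hBcard : #B ≤ 20 := by
    have h1 : #B ≤ #{P ∈ S | ¬ PGmem P L} + #C := card_union_le _ _
    have h2 : #A + #{P ∈ S | ¬ PGmem P L} = #S :=
      card_filter_add_card_filter_not (s := S) (fun P => PGmem P L)
    have h3 : #(A.image t) ≤ #A := card_image_le
    omega
  have hBne : B.Nonempty := by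
    obtain ⟨P, hP⟩ := card_pos.1 (show 0 < #A by omega)
    obtain ⟨Q, hQ, -⟩ := hCT (t P) (mem_image_of_mem t hP)
    exact ⟨Q, mem_union_right _ hQ⟩
  obtain ⟨M, hML, hM⟩ := exists_line_missing B hBne hBcard L hBL
  have hSM : ∀ P ∈ S, PGmem P M → PGmem P L := fun P hP hPM => by
    by_contra h
    exact hM P (mem_union_left _ (mem_filter.2 ⟨hP, h⟩)) hPM
  obtain ⟨P, hP, hPM⟩ := hblock M
  have htP : M = t P := htu P hP M ⟨hPM, by
    refine Set.ncard_eq_one.2 ⟨P, Set.eq_singleton_iff_unique_mem.2 ⟨⟨hP, hPM⟩, ?_⟩⟩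
    rintro Q ⟨hQ, hQM⟩
    exact eq_of_mem_two_lines hML hQM (hSM Q hQ hQM) hPM (hSM P hP hPM)⟩
  obtain ⟨Q, hQC, hQ⟩ := hCT M (htP ▸ mem_image_of_mem t (mem_filter.2 ⟨hP, hSM P hP hPM⟩))
  exact hM Q (mem_union_right _ hQC) hQ

theorem no_blocking_semioval_of_size_25 :
    ¬ ∃ S : Set PGPoint, IsBlockingSemioval S ∧ S.ncard = 25 := by
  classical
  rintro ⟨S, hS, hcard⟩
  have hlt := hS.ncard_secantPts_lt_ten hcard
  lift S to Finset PGPoint using S.toFinite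
  rw [Set.ncard_coe_finset] at hcard
  simp only [ncard_secantPts_coe] at hlt
  have := Fintype.ofFinite PGPoint
  have := Fintype.ofFinite PGLine
  have hone : ∀ (p : PGLine → Prop) [DecidablePred p], (∃! L, p L) → #{L | p L} = 1 :=
    fun p _ ⟨L, hL, hLu⟩ => card_eq_one.2 ⟨L, by ext M; simpa using ⟨hLu M, fun h => h ▸ hL⟩⟩
  obtain ⟨L, hL⟩ := exists_ten_le_secant_of_semioval_card_25 (I := PGmem)
    (fun P Q hPQ => hone _ (existsUnique_line hPQ))
    (by rw [← Nat.card_eq_fintype_card, card_PGPoint])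
    (fun L => by
      rw [← ncard_linePts L, ← Set.ncard_coe_finset]
      simp [linePts])
    S hcard
    (fun L => by
      obtain ⟨P, hP⟩ := hS.1.1 L
      exact card_pos.2 ⟨P, by simpa [secantPts] using hP⟩)
    (fun P hP => hone _ (by simpa only [IsTangent, IsSecant, ncard_secantPts_coe] using hS.2 P hP))
  exact absurd (hlt L) hL.not_gt
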